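/- Optimality of primal limit points (Theorem 1, part 2): suppose γ satisfies the diminishing condition, the set of minimizers of η is nonempty, and sequences λ^{ij}(t) ∈ ℝ^S for (i,j) ∈ E, μ^i(t) ∈ ℝ^S, x^i(t) ∈ ℝ^S and ρ^i(t) ∈ ℝ for i ∈ {1,…,N} satisfy for all t ∈ ℕ: (i) for each i, μ^i(t+1) maximizes μ ↦ q^i(μ) + μᵀ Σ_{j∈N_i}(λ^{ij}(t) − λ^{ji}(t)) over Δ; (ii) for each i, x^i(t+1) ∈ X^i minimizes x ↦ max_{s ∈ {1,…,S}} ( g^i_s(x_s) + ( Σ_{j∈N_i}(λ^{ij}(t) − λ^{ji}(t)) )_s ) over X^i, and ρ^i(t+1) is this minimum value; (iii) for each (i,j) ∈ E, λ^{ij}(t+1) = λ^{ij}(t) − γ(t)(μ^i(t+1) − μ^j(t+1)). Then for every strictly increasing sequence of times t_n and vectors x̄^1,…,x̄^N such that x^i(t_n) → x̄^i as n → ∞ for every i, one has x̄^i ∈ X^i for every i and max_{s ∈ {1,…,S}} Σ_{i=1}^N g^i_s(x̄^i_s) = P*; that is, every limit point of the primal sequence is a feasible optimal solution of the min-max problem.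 -/

import Mathlib

open Finset Filter Topology

noncomputable section

/-- The unit simplex in `ℝ^S`. -/
def unitSimplex (S : ℕ) : Set (Fin S → ℝ) :=
  {μ | (∀ s, 0 ≤ μ s) ∧ ∑ s, μ s = 1}

/-- The local dual function `q^i(μ) = inf_{x ∈ X^i} Σ_s μ_s g^i_s(x_s)`. -/
def dualFn {N S : ℕ} (X : Fin N → Set (Fin S → ℝ))
    (g : Fin N → Fin S → ℝ → ℝ) (i : Fin N) (μ : Fin S → ℝ) : ℝ :=
  sInf ((fun x : Fin S → ℝ => ∑ s, μ s * g i s (x s)) '' X i)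

/-- The set of achievable primal (min-max) values. -/
def primalSet {N S : ℕ} (X : Fin N → Set (Fin S → ℝ))
    (g : Fin N → Fin S → ℝ → ℝ) : Set ℝ :=
  {P | ∃ x : Fin N → Fin S → ℝ, (∀ i, x i ∈ X i) ∧
    P = ⨆ s : Fin S, ∑ i, g i s (x i s)}

/-- `Σ_{j ∈ N_i} (λ^{ij} − λ^{ji})`. -/
def edgeDiff {N S : ℕ} (G : SimpleGraph (Fin N)) [DecidableRel G.Adj]
    (lam : Fin N → Fin N → Fin S → ℝ) (i : Fin N) : Fin S → ℝ :=
  ∑ j ∈ Finset.univ.filter (fun j => G.Adj i j), (lam i j - lam j i)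

/-- The dual-of-dual objective `η({λ^{ij}}) = Σ_i η^i`. -/
def etaFn {N S : ℕ} (X : Fin N → Set (Fin S → ℝ))
    (g : Fin N → Fin S → ℝ → ℝ) (G : SimpleGraph (Fin N)) [DecidableRel G.Adj]
    (lam : Fin N → Fin N → Fin S → ℝ) : ℝ :=
  ∑ i, sSup {v | ∃ μ ∈ unitSimplex S,
    v = dualFn X g i μ + ∑ s, μ s * edgeDiff G lam i s}

/-! ### The subgradient method with diminishing steps -/

/-- A nonnegative sequence whose increments are of order `γ` tends to zero as soon as its
`γ`-weighted sum is finite while `γ` itself has infinite sum. -/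
lemma tendsto_zero_of_summable_mul {a γ : ℕ → ℝ} {C : ℝ} (ha : ∀ t, 0 ≤ a t)
    (hγ : ∀ t, 0 ≤ γ t) (hγdiv : Tendsto (fun n => ∑ t ∈ Finset.range n, γ t) atTop atTop)
    (hγsq : Summable (fun t => γ t ^ 2)) (hsum : Summable (fun t => γ t * a t))
    (hstep : ∀ t, |a (t + 1) - a t| ≤ C * γ t) : Tendsto a atTop (𝓝 0) := by
  have hcauchy : CauchySeq (fun t => a t ^ 2) := by
    refine cauchySeq_of_summable_dist (Summable.of_nonneg_of_le (fun _ => dist_nonneg)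
      (fun t => ?_) ((hsum.mul_left (2 * C)).add (hγsq.mul_left (C ^ 2))))
    rw [dist_comm, Real.dist_eq, sq_sub_sq, abs_mul,
      abs_of_nonneg (add_nonneg (ha (t + 1)) (ha t)), mul_comm]
    have h1 : a (t + 1) + a t ≤ 2 * a t + C * γ t := by
      linarith [le_abs_self (a (t + 1) - a t), hstep t]
    calc |a (t + 1) - a t| * (a (t + 1) + a t) ≤ C * γ t * (2 * a t + C * γ t) :=
          mul_le_mul (hstep t) h1 (add_nonneg (ha _) (ha _)) ((abs_nonneg _).trans (hstep t))
      _ = _ := by ring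
  obtain ⟨l, hl⟩ := cauchySeq_tendsto_of_complete hcauchy
  have hl0 : 0 ≤ l := ge_of_tendsto' hl fun t => sq_nonneg (a t)
  have hal : Tendsto a atTop (𝓝 (√l)) := by
    simpa only [Real.sqrt_sq (ha _)] using hl.sqrt
  suffices √l = 0 by rwa [this] at hal
  by_contra hne
  have hpos : 0 < √l := lt_of_le_of_ne (Real.sqrt_nonneg l) (Ne.symm hne)
  obtain ⟨T, hT⟩ := eventually_atTop.1 (hal.eventually (lt_mem_nhds (half_lt_self hpos)))
  have hγsum : Summable γ := by
    refine (summable_nat_add_iff T).1 (Summable.of_nonneg_of_le (fun t => hγ _) (fun t => ?_)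
      (((summable_nat_add_iff T).2 hsum).mul_left (√l / 2)⁻¹))
    rw [inv_mul_eq_div, le_div_iff₀ (by positivity)]
    exact mul_le_mul_of_nonneg_left (hT _ (Nat.le_add_left T t)).le (hγ _)
  exact not_tendsto_nhds_of_tendsto_atTop hγdiv _ hγsum.hasSum.tendsto_sum_nat

/-- The subgradient method with bounded subgradients and square-summable, non-summable steps
drives the objective to its minimum. -/
lemma tendsto_subgradient_method {E : Type*} [NormedAddCommGroup E] [InnerProductSpace ℝ E]
    {f : E → ℝ} {u d : ℕ → E} {γ : ℕ → ℝ} {C : ℝ} {z : E} (hz : ∀ v, f z ≤ f v)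
    (hd : ∀ t, ‖d t‖ ≤ C) (hsub : ∀ t v, f (u t) ≤ f v + inner ℝ (d t) (u t - v))
    (hu : ∀ t, u (t + 1) = u t - γ t • d t) (hγ : ∀ t, 0 ≤ γ t)
    (hγdiv : Tendsto (fun n => ∑ t ∈ Finset.range n, γ t) atTop atTop)
    (hγsq : Summable (fun t => γ t ^ 2)) :
    Tendsto (fun t => f (u t)) atTop (𝓝 (f z)) := by
  have hd2 : ∀ t, ‖d t‖ ^ 2 ≤ C ^ 2 := fun t =>
    pow_le_pow_left₀ (norm_nonneg _) (hd t) 2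
  have ha : ∀ t, 0 ≤ f (u t) - f z := fun t => sub_nonneg.2 (hz _)
  have hinner : ∀ t s, |inner ℝ (d s) (d t)| ≤ C ^ 2 := fun t s =>
    (abs_real_inner_le_norm _ _).trans <| by
      rw [pow_two]
      exact mul_le_mul (hd s) (hd t) (norm_nonneg _) ((norm_nonneg _).trans (hd s))
  have hfejer : ∀ t, 2 * (γ t * (f (u t) - f z)) ≤
      ‖u t - z‖ ^ 2 - ‖u (t + 1) - z‖ ^ 2 + C ^ 2 * γ t ^ 2 := by
    intro t
    have h1 : ‖u (t + 1) - z‖ ^ 2 =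
        ‖u t - z‖ ^ 2 - 2 * (γ t * inner ℝ (d t) (u t - z)) + γ t ^ 2 * ‖d t‖ ^ 2 := by
      rw [hu t, sub_right_comm, norm_sub_sq_real, inner_smul_right, real_inner_comm, norm_smul,
        mul_pow, Real.norm_eq_abs, sq_abs]
    have h2 := mul_le_mul_of_nonneg_left (sub_le_iff_le_add'.2 (hsub t z)) (hγ t)
    have h3 := mul_le_mul_of_nonneg_left (hd2 t) (sq_nonneg (γ t))
    linarith
  have hsum : Summable (fun t => γ t * (f (u t) - f z)) := by
    refine summable_of_sum_range_le (c := (‖u 0 - z‖ ^ 2 + C ^ 2 * ∑' t, γ t ^ 2) / 2)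
      (fun t => mul_nonneg (hγ t) (ha t)) fun n => ?_
    have h1 := Finset.sum_le_sum fun t (_ : t ∈ Finset.range n) => hfejer t
    rw [Finset.sum_add_distrib, Finset.sum_range_sub', ← Finset.mul_sum, ← Finset.mul_sum] at h1
    have h2 := mul_le_mul_of_nonneg_left
      (hγsq.sum_le_tsum (Finset.range n) fun t _ => sq_nonneg (γ t)) (sq_nonneg C)
    linarith [sq_nonneg ‖u n - z‖]
  have hstep : ∀ t, |(f (u (t + 1)) - f z) - (f (u t) - f z)| ≤ C ^ 2 * γ t := by
    intro t
    have h1 := hsub t (u (t + 1))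
    have h2 := hsub (t + 1) (u t)
    rw [hu t, sub_sub_cancel, inner_smul_right, ← hu t] at h1
    rw [hu t, sub_sub_cancel_left, inner_neg_right, inner_smul_right, ← hu t] at h2
    have h3 := mul_le_mul_of_nonneg_left ((le_abs_self _).trans (hinner t t)) (hγ t)
    have h4 := mul_le_mul_of_nonneg_left ((neg_le_abs _).trans (hinner t (t + 1))) (hγ t)
    rw [abs_le]
    constructor <;> linarith
  simpa using (tendsto_zero_of_summable_mul ha hγ hγdiv hγsq hsum hstep).add_const (f z)

/-! ### Local duality -/

/-- A finite family of convex functions whose pointwise maximum is at least `r` on a convex set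
has a convex combination that is at least `r` on this set. -/
lemma exists_mem_unitSimplex_le_sum {E : Type*} [AddCommGroup E] [Module ℝ E] {S : ℕ}
    {X : Set E} (hne : X.Nonempty) (hX : Convex ℝ X) {f : Fin S → E → ℝ}
    (hf : ∀ s, ConvexOn ℝ X (f s)) {r : ℝ} (hr : ∀ x ∈ X, ∃ s, r ≤ f s x) :
    ∃ μ ∈ unitSimplex S, ∀ x ∈ X, r ≤ ∑ s, μ s * f s x := by
  set A : Set (Fin S → ℝ) := {v | ∃ x ∈ X, ∀ s, f s x ≤ v s}
  set B : Set (Fin S → ℝ) := Set.univ.pi fun _ => Set.Iio r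
  have hA : Convex ℝ A := by
    rintro v ⟨x, hx, hxv⟩ w ⟨y, hy, hyw⟩ a b ha hb hab
    refine ⟨a • x + b • y, hX hx hy ha hb hab, fun s => ((hf s).2 hx hy ha hb hab).trans ?_⟩
    simpa using add_le_add (mul_le_mul_of_nonneg_left (hxv s) ha)
      (mul_le_mul_of_nonneg_left (hyw s) hb)
  have hAB : Disjoint B A := by
    rw [Set.disjoint_left]
    rintro v hv ⟨x, hx, hxv⟩
    obtain ⟨s, hs⟩ := hr x hx
    exact absurd (hs.trans (hxv s)) (not_le.2 (hv s trivial))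
  obtain ⟨φ, u, hB, hA'⟩ := geometric_hahn_banach_open
    (convex_pi fun _ _ => convex_Iio r) (isOpen_set_pi Set.finite_univ fun _ _ => isOpen_Iio)
    hA hAB
  set p : Fin S → ℝ := fun s => φ (Pi.single s 1)
  have hφ : ∀ v, φ v = ∑ s, p s * v s := by
    intro v
    conv_lhs => rw [pi_eq_sum_univ' v]
    simp [p, mul_comm, map_sum]
  have hconst : ∀ b < r, (∑ s, p s) * b < u := by
    intro b hb
    have := hB (fun _ => b) fun s _ => hb
    rwa [hφ, ← Finset.sum_mul] at this
  have hp : ∀ s, 0 ≤ p s := by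
    intro s
    by_contra! hs
    obtain ⟨n, hn⟩ := exists_nat_gt ((u - (∑ s, p s) * (r - 1)) / -p s)
    rw [div_lt_iff₀ (by linarith)] at hn
    have := hB ((fun _ => r - 1) - (n : ℝ) • Pi.single s 1) fun k _ => by
      have : (0 : ℝ) ≤ (n : ℝ) * (Pi.single s 1 : Fin S → ℝ) k :=
        mul_nonneg n.cast_nonneg (by by_cases h : k = s <;> simp [h])
      simp only [Set.mem_Iio, Pi.sub_apply, Pi.smul_apply, smul_eq_mul]
      linarith
    rw [map_sub, map_smul, hφ, ← Finset.sum_mul, smul_eq_mul] at this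
    change _ - (n : ℝ) * p s < u at this
    linarith
  have hru : (∑ s, p s) * r ≤ u := by
    refine le_of_tendsto (x := 𝓝[<] r) (f := fun b => (∑ s, p s) * b) ?_
      (eventually_nhdsWithin_of_forall fun b hb => (hconst b hb).le)
    exact ((continuous_const.mul continuous_id).tendsto r).mono_left nhdsWithin_le_nhds
  have hle : ∀ x ∈ X, u ≤ ∑ s, p s * f s x := fun x hx =>
    (hA' (fun s => f s x) ⟨x, hx, fun _ => le_rfl⟩).trans_eq (hφ _)
  have hpos : 0 < ∑ s, p s := by
    refine lt_of_le_of_ne (Finset.sum_nonneg fun s _ => hp s) fun h0 => ?_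
    have hp0 : ∀ s, p s = 0 := fun s =>
      (Finset.sum_eq_zero_iff_of_nonneg fun s _ => hp s).1 h0.symm s (Finset.mem_univ s)
    obtain ⟨x, hx⟩ := hne
    have h1 := hle x hx
    have h2 := hconst (r - 1) (by linarith)
    simp only [hp0, zero_mul, Finset.sum_const_zero] at h1 h2
    linarith
  refine ⟨fun s => p s / ∑ k, p k, ⟨fun s => div_nonneg (hp s) hpos.le, ?_⟩, fun x hx => ?_⟩
  · rw [← Finset.sum_div, div_self hpos.ne']
  · simp_rw [div_mul_eq_mul_div]
    rw [← Finset.sum_div, le_div_iff₀ hpos, mul_comm]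
    exact hru.trans (hle x hx)

lemma sum_mul_le_of_mem_unitSimplex {S : ℕ} {μ v : Fin S → ℝ} {r : ℝ} (hμ : μ ∈ unitSimplex S)
    (hv : ∀ s, v s ≤ r) : ∑ s, μ s * v s ≤ r :=
  calc ∑ s, μ s * v s ≤ ∑ s, μ s * r :=
        Finset.sum_le_sum fun s _ => mul_le_mul_of_nonneg_left (hv s) (hμ.1 s)
    _ = r := by rw [← Finset.sum_mul, hμ.2, one_mul]

section Duality

variable {N S : ℕ} {X : Fin N → Set (Fin S → ℝ)} {g : Fin N → Fin S → ℝ → ℝ}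

/-- The optimal value `η^i` of the dual problem of agent `i` perturbed by `c`. -/
def localValue (X : Fin N → Set (Fin S → ℝ)) (g : Fin N → Fin S → ℝ → ℝ) (i : Fin N)
    (c : Fin S → ℝ) : ℝ :=
  sSup {v | ∃ μ ∈ unitSimplex S, v = dualFn X g i μ + ∑ s, μ s * c s}

lemma dualFn_le {i : Fin N} (hX : IsCompact (X i)) (hg : ∀ s, Continuous (g i s))
    (μ : Fin S → ℝ) {x : Fin S → ℝ} (hx : x ∈ X i) :
    dualFn X g i μ ≤ ∑ s, μ s * g i s (x s) :=
  csInf_le (hX.bddBelow_image (Continuous.continuousOn (by fun_prop)))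
    (Set.mem_image_of_mem _ hx)

lemma dualFn_add_le {i : Fin N} (hX : IsCompact (X i)) (hg : ∀ s, Continuous (g i s))
    {μ c x : Fin S → ℝ} {r : ℝ} (hμ : μ ∈ unitSimplex S) (hx : x ∈ X i)
    (hr : ∀ s, g i s (x s) + c s ≤ r) : dualFn X g i μ + ∑ s, μ s * c s ≤ r :=
  calc dualFn X g i μ + ∑ s, μ s * c s ≤ ∑ s, μ s * g i s (x s) + ∑ s, μ s * c s :=
        add_le_add_left (dualFn_le hX hg μ hx) _
    _ = ∑ s, μ s * (g i s (x s) + c s) := by simp only [mul_add, Finset.sum_add_distrib]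
    _ ≤ r := sum_mul_le_of_mem_unitSimplex hμ hr

lemma dualFn_add_le_localValue {i : Fin N} (hne : (X i).Nonempty) (hX : IsCompact (X i))
    (hg : ∀ s, Continuous (g i s)) {μ : Fin S → ℝ} (hμ : μ ∈ unitSimplex S) (c : Fin S → ℝ) :
    dualFn X g i μ + ∑ s, μ s * c s ≤ localValue X g i c := by
  obtain ⟨x, hx⟩ := hne
  refine le_csSup ⟨⨆ s, (g i s (x s) + c s), ?_⟩ ⟨μ, hμ, rfl⟩
  rintro _ ⟨ν, hν, rfl⟩
  exact dualFn_add_le hX hg hν hx (le_ciSup (Set.finite_range _).bddAbove)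

/-- Weak duality for the problem of a single agent. -/
lemma localValue_le (hS : 0 < S) {i : Fin N} (hX : IsCompact (X i))
    (hg : ∀ s, Continuous (g i s)) {c x : Fin S → ℝ} {r : ℝ} (hx : x ∈ X i)
    (hr : ∀ s, g i s (x s) + c s ≤ r) : localValue X g i c ≤ r := by
  refine csSup_le ⟨_, Pi.single ⟨0, hS⟩ 1, ⟨fun s => ?_, by simp⟩, rfl⟩ ?_
  · by_cases h : s = ⟨0, hS⟩ <;> simp [h]
  · rintro _ ⟨μ, hμ, rfl⟩
    exact dualFn_add_le hX hg hμ hx hr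

/-- Strong duality for the problem of a single agent. -/
lemma le_localValue (hS : 0 < S) {i : Fin N} (hne : (X i).Nonempty) (hconv : Convex ℝ (X i))
    (hX : IsCompact (X i)) (hg : ∀ s, ConvexOn ℝ Set.univ (g i s))
    (hgc : ∀ s, Continuous (g i s)) {c : Fin S → ℝ} {r : ℝ}
    (hr : ∀ x ∈ X i, r ≤ ⨆ s, (g i s (x s) + c s)) : r ≤ localValue X g i c := by
  have : Nonempty (Fin S) := ⟨⟨0, hS⟩⟩
  obtain ⟨μ, hμ, hle⟩ := exists_mem_unitSimplex_le_sum (f := fun s x => g i s (x s) + c s) hne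
    hconv (fun s => (((hg s).comp_linearMap (LinearMap.proj (φ := fun _ => ℝ) s)).subset
      (Set.subset_univ _) hconv).add_const (c s)) (r := r) fun x hx => by
        obtain ⟨s, hs⟩ := exists_eq_ciSup_of_finite (f := fun s => g i s (x s) + c s)
        exact ⟨s, (hr x hx).trans_eq hs.symm⟩
  refine le_trans ?_ (dualFn_add_le_localValue hne hX hgc hμ c)
  rw [← sub_le_iff_le_add]
  refine le_csInf (hne.image _) ?_
  rintro _ ⟨x, hx, rfl⟩
  have := hle x hx
  simp only [mul_add, Finset.sum_add_distrib] at this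
  linarith

end Duality

/-! ### Edge differences -/

section EdgeDiff

variable {N S : ℕ} (G : SimpleGraph (Fin N)) [DecidableRel G.Adj]

lemma edgeDiff_eq_sum_ite (lam : Fin N → Fin N → Fin S → ℝ) (i : Fin N) :
    edgeDiff G lam i = ∑ j, if G.Adj i j then lam i j - lam j i else 0 :=
  Finset.sum_filter _ _

lemma sum_edgeDiff (lam : Fin N → Fin N → Fin S → ℝ) : ∑ i, edgeDiff G lam i = 0 := by
  have h : ∑ i, edgeDiff G lam i = -∑ i, edgeDiff G lam i := by
    simp only [edgeDiff_eq_sum_ite]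
    conv_lhs => rw [Finset.sum_comm]
    simp only [← Finset.sum_neg_distrib]
    refine Finset.sum_congr rfl fun i _ => Finset.sum_congr rfl fun j _ => ?_
    by_cases hij : G.Adj i j <;> simp [hij, G.adj_comm j i]
  exact self_eq_neg.1 h

/-- `edgeDiff` as a linear map. -/
def edgeDiffLinearMap (S : ℕ) : (Fin N → Fin N → Fin S → ℝ) →ₗ[ℝ] (Fin N → Fin S → ℝ) where
  toFun := edgeDiff G
  map_add' a b := by
    ext1 i
    simp only [edgeDiff, Pi.add_apply, ← Finset.sum_add_distrib]
    exact Finset.sum_congr rfl fun j _ => by abel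
  map_smul' r a := by
    ext1 i
    simp only [edgeDiff, Pi.smul_apply, Finset.smul_sum, smul_sub, RingHom.id_apply]

lemma edgeDiff_sub (a b : Fin N → Fin N → Fin S → ℝ) :
    edgeDiff G (a - b) = edgeDiff G a - edgeDiff G b :=
  map_sub (edgeDiffLinearMap G S) a b

variable {G}

lemma single_sub_single_mem_range_edgeDiff {i j : Fin N} (hij : G.Reachable i j)
    (v : Fin S → ℝ) :
    (Pi.single i v - Pi.single j v : Fin N → Fin S → ℝ) ∈
      LinearMap.range (edgeDiffLinearMap G S) := by
  obtain ⟨w⟩ := hij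
  induction w with
  | nil => simp
  | @cons a b c hab _ ih =>
    rw [← sub_add_sub_cancel _ (Pi.single b v)]
    refine add_mem ⟨Pi.single a (Pi.single b v), ?_⟩ ih
    change edgeDiff G _ = _
    ext1 k
    rw [edgeDiff_eq_sum_ite, Pi.sub_apply]
    have hne := hab.ne
    have key : ∀ l, (if G.Adj k l then
        (Pi.single a (Pi.single b v) : Fin N → Fin N → Fin S → ℝ) k l -
          (Pi.single a (Pi.single b v) : Fin N → Fin N → Fin S → ℝ) l k else 0) =
        (if l = b then (if k = a then v else 0) else 0) -
          (if l = a then (if k = b then v else 0) else 0) := by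
      intro l
      by_cases h1 : k = a <;> by_cases h2 : l = b <;> by_cases h3 : l = a <;>
        by_cases h4 : k = b <;> simp_all [G.adj_comm]
    rw [Finset.sum_congr rfl fun l _ => key l, Finset.sum_sub_distrib]
    simp [Pi.single_apply]

/-- On a connected graph, every family of vectors with zero sum is a family of edge
differences. -/
lemma exists_edgeDiff_eq (hG : G.Connected) {c : Fin N → Fin S → ℝ} (hc : ∑ i, c i = 0) :
    ∃ lam, edgeDiff G lam = c := by
  obtain ⟨r⟩ := hG.nonempty
  have hmem : ∑ i, (Pi.single i (c i) - Pi.single r (c i) : Fin N → Fin S → ℝ) ∈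
      LinearMap.range (edgeDiffLinearMap G S) :=
    sum_mem fun i _ => single_sub_single_mem_range_edgeDiff (hG.preconnected i r) (c i)
  have hsum : ∑ i, (Pi.single r (c i) : Fin N → Fin S → ℝ) = 0 := by
    rw [← map_zero (AddMonoidHom.single (fun _ : Fin N => Fin S → ℝ) r), ← hc, map_sum]
    rfl
  rw [Finset.sum_sub_distrib, Finset.univ_sum_single, hsum, sub_zero] at hmem
  exact hmem

/-- Summation by parts over the edges. -/
lemma sum_mul_edgeDiff (μ : Fin N → Fin S → ℝ) (lam : Fin N → Fin N → Fin S → ℝ) :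
    ∑ i, ∑ s, μ i s * edgeDiff G lam i s =
      ∑ i, ∑ j, ∑ s, if G.Adj i j then (μ i s - μ j s) * lam i j s else 0 := by
  have h1 : ∑ i, ∑ s, μ i s * edgeDiff G lam i s =
      ∑ i, ∑ j, ∑ s, ((if G.Adj i j then μ i s * lam i j s else 0) -
        if G.Adj i j then μ i s * lam j i s else 0) := by
    refine Finset.sum_congr rfl fun i _ => ?_
    rw [Finset.sum_comm]
    refine Finset.sum_congr rfl fun s _ => ?_
    rw [edgeDiff_eq_sum_ite, Finset.sum_apply, Finset.mul_sum]
    refine Finset.sum_congr rfl fun j _ => ?_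
    split_ifs <;> simp [mul_sub]
  have h2 : ∑ i, ∑ j, ∑ s, (if G.Adj i j then μ i s * lam j i s else 0) =
      ∑ i, ∑ j, ∑ s, if G.Adj i j then μ j s * lam i j s else 0 := by
    rw [Finset.sum_comm]
    simp only [G.adj_comm]
  rw [h1]
  simp only [Finset.sum_sub_distrib]
  rw [h2]
  simp only [← Finset.sum_sub_distrib]
  refine Finset.sum_congr rfl fun i _ => Finset.sum_congr rfl fun j _ =>
    Finset.sum_congr rfl fun s _ => ?_
  split_ifs <;> ring

end EdgeDiff

/-! ### The global dual problem -/

section Global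

variable {N S : ℕ} {X : Fin N → Set (Fin S → ℝ)} {g : Fin N → Fin S → ℝ → ℝ}
  {G : SimpleGraph (Fin N)} [DecidableRel G.Adj]

/-- Every feasible primal value is attained as an upper bound of the dual objective at some
family of multipliers. -/
lemma exists_etaFn_le (hN : 0 < N) (hS : 0 < S) (hX : ∀ i, IsCompact (X i))
    (hg : ∀ i s, Continuous (g i s)) (hG : G.Connected) {y : Fin N → Fin S → ℝ}
    (hy : ∀ i, y i ∈ X i) : ∃ lam, etaFn X g G lam ≤ ⨆ s, ∑ i, g i s (y i s) := by
  have hN' : (N : ℝ) ≠ 0 := Nat.cast_ne_zero.2 hN.ne'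
  obtain ⟨lam, hlam⟩ := exists_edgeDiff_eq hG
    (c := fun i s => (∑ k, g k s (y k s)) / N - g i s (y i s)) <| by
      ext s
      simp [Finset.sum_apply, Finset.sum_sub_distrib, mul_div_cancel₀ _ hN']
  refine ⟨lam, ?_⟩
  calc etaFn X g G lam = ∑ i, localValue X g i (edgeDiff G lam i) := rfl
    _ ≤ ∑ _i : Fin N, (⨆ s, ∑ k, g k s (y k s)) / N := by
        refine Finset.sum_le_sum fun i _ => localValue_le hS (hX i) (hg i) (hy i) fun s => ?_
        rw [hlam, add_sub_cancel]
        exact div_le_div_of_nonneg_right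
          (le_ciSup (f := fun s => ∑ k, g k s (y k s)) (Set.finite_range _).bddAbove s)
          N.cast_nonneg
    _ = ⨆ s, ∑ k, g k s (y k s) := by simp [mul_div_cancel₀ _ hN']

/-- Local maximizers provide a subgradient of the dual objective. -/
lemma etaFn_le_add_sum (hne : ∀ i, (X i).Nonempty) (hX : ∀ i, IsCompact (X i))
    (hg : ∀ i s, Continuous (g i s)) {lam : Fin N → Fin N → Fin S → ℝ}
    {μ : Fin N → Fin S → ℝ}
    (hμ : ∀ i, μ i ∈ unitSimplex S ∧ ∀ ν ∈ unitSimplex S,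
      dualFn X g i ν + ∑ s, ν s * edgeDiff G lam i s ≤
        dualFn X g i (μ i) + ∑ s, μ i s * edgeDiff G lam i s)
    (lam' : Fin N → Fin N → Fin S → ℝ) :
    etaFn X g G lam ≤ etaFn X g G lam' + ∑ i, ∑ j, ∑ s,
      if G.Adj i j then (μ i s - μ j s) * (lam i j s - lam' i j s) else 0 := by
  have h := sum_mul_edgeDiff (G := G) μ (lam - lam')
  simp only [Pi.sub_apply] at h
  rw [← h, edgeDiff_sub]
  change ∑ i, localValue X g i (edgeDiff G lam i) ≤
    ∑ i, localValue X g i (edgeDiff G lam' i) + _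
  rw [← Finset.sum_add_distrib]
  refine Finset.sum_le_sum fun i _ => ?_
  have h1 : localValue X g i (edgeDiff G lam i) ≤
      dualFn X g i (μ i) + ∑ s, μ i s * edgeDiff G lam i s := by
    refine csSup_le ⟨_, μ i, (hμ i).1, rfl⟩ ?_
    rintro _ ⟨ν, hν, rfl⟩
    exact (hμ i).2 ν hν
  have h2 := dualFn_add_le_localValue (hne i) (hX i) (hg i) (hμ i).1 (edgeDiff G lam' i)
  simp only [Pi.sub_apply, mul_sub, Finset.sum_sub_distrib]
  linarith

/-- Restriction of edge multipliers to the edges of the graph. -/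
def maskEdges (G : SimpleGraph (Fin N)) [DecidableRel G.Adj] (lam : Fin N → Fin N → Fin S → ℝ) :
    EuclideanSpace ℝ (Fin N × Fin N × Fin S) :=
  WithLp.toLp 2 fun e => if G.Adj e.1 e.2.1 then lam e.1 e.2.1 e.2.2 else 0

lemma edgeDiff_maskEdges (lam : Fin N → Fin N → Fin S → ℝ) :
    edgeDiff G (fun i j s => maskEdges G lam (i, j, s)) = edgeDiff G lam := by
  ext i s
  simp only [edgeDiff, Finset.sum_apply]
  refine Finset.sum_congr rfl fun j hj => ?_
  have hij := (Finset.mem_filter.1 hj).2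
  simp [maskEdges, hij, hij.symm]

lemma etaFn_maskEdges (lam : Fin N → Fin N → Fin S → ℝ) :
    etaFn X g G (fun i j s => maskEdges G lam (i, j, s)) = etaFn X g G lam := by
  rw [etaFn, edgeDiff_maskEdges, etaFn]

lemma norm_maskEdges_sub_le {μ : Fin N → Fin S → ℝ} (hμ : ∀ i, μ i ∈ unitSimplex S) :
    ‖maskEdges G fun i j => μ i - μ j‖ ≤ √(N * (N * S)) := by
  have hle : ∀ i s, μ i s ≤ 1 := fun i s =>
    (Finset.single_le_sum (fun k _ => (hμ i).1 k) (Finset.mem_univ s)).trans_eq (hμ i).2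
  rw [EuclideanSpace.norm_eq]
  refine Real.sqrt_le_sqrt ((Finset.sum_le_sum (g := fun _ => (1 : ℝ)) fun e _ => ?_).trans_eq
    (by simp))
  rw [Real.norm_eq_abs, sq_abs, sq_le_one_iff_abs_le_one, abs_le]
  have h1 := hle e.1 e.2.2
  have h2 := hle e.2.1 e.2.2
  have h3 := (hμ e.1).1 e.2.2
  have h4 := (hμ e.2.1).1 e.2.2
  simp only [maskEdges, Pi.sub_apply]
  split_ifs <;> constructor <;> linarith

/-- The dual objective converges to its minimum along the distributed iteration. -/
lemma tendsto_etaFn (hne : ∀ i, (X i).Nonempty) (hX : ∀ i, IsCompact (X i))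
    (hg : ∀ i s, Continuous (g i s)) {γ : ℕ → ℝ} (hγ : ∀ t, 0 ≤ γ t)
    (hγdiv : Tendsto (fun n => ∑ t ∈ Finset.range n, γ t) atTop atTop)
    (hγsq : Summable (fun t => γ t ^ 2)) {lamstar : Fin N → Fin N → Fin S → ℝ}
    (hmin : ∀ lam, etaFn X g G lamstar ≤ etaFn X g G lam)
    {lam : ℕ → Fin N → Fin N → Fin S → ℝ} {μ : ℕ → Fin N → Fin S → ℝ}
    (hmax : ∀ t i, μ (t + 1) i ∈ unitSimplex S ∧ ∀ ν ∈ unitSimplex S,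
      dualFn X g i ν + ∑ s, ν s * edgeDiff G (lam t) i s ≤
        dualFn X g i (μ (t + 1) i) + ∑ s, μ (t + 1) i s * edgeDiff G (lam t) i s)
    (hupd : ∀ t i j, G.Adj i j →
      lam (t + 1) i j = lam t i j - γ t • (μ (t + 1) i - μ (t + 1) j)) :
    Tendsto (fun t => etaFn X g G (lam t)) atTop (𝓝 (etaFn X g G lamstar)) := by
  have h := tendsto_subgradient_method
    (f := fun v : EuclideanSpace ℝ (Fin N × Fin N × Fin S) =>
      etaFn X g G fun i j s => v (i, j, s))
    (u := fun t => maskEdges G (lam t))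
    (d := fun t => maskEdges G fun i j => μ (t + 1) i - μ (t + 1) j)
    (z := maskEdges G lamstar) (γ := γ) (fun v => by rw [etaFn_maskEdges]; exact hmin _)
    (fun t => norm_maskEdges_sub_le fun i => (hmax t i).1) (fun t v => ?_) (fun t => ?_)
    hγ hγdiv hγsq
  · simpa only [etaFn_maskEdges] using h
  · rw [etaFn_maskEdges]
    refine (etaFn_le_add_sum hne hX hg (hmax t) fun i j s => v (i, j, s)).trans_eq ?_
    rw [PiLp.inner_apply]
    simp only [Fintype.sum_prod_type]
    congr 1
    refine Finset.sum_congr rfl fun i _ => Finset.sum_congr rfl fun j _ =>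
      Finset.sum_congr rfl fun s _ => ?_
    by_cases hij : G.Adj i j <;> simp [maskEdges, hij, mul_comm]
  · ext ⟨i, j, s⟩
    by_cases hij : G.Adj i j <;> simp [maskEdges, hij, hupd]

end Global

/-- Optimality of primal limit points (Theorem 1, part 2): every limit point of the
primal sequence generated by the distributed min-max algorithm is a feasible
optimal solution of the min-max problem. -/
theorem distributed_minmax_primal_limit_points (N S : ℕ) (hN : 0 < N) (hS : 0 < S)
    (X : Fin N → Set (Fin S → ℝ))
    (hXne : ∀ i, (X i).Nonempty)
    (hXconv : ∀ i, Convex ℝ (X i))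
    (hXcomp : ∀ i, IsCompact (X i))
    (g : Fin N → Fin S → ℝ → ℝ)
    (hg : ∀ i s, ConvexOn ℝ Set.univ (g i s))
    (G : SimpleGraph (Fin N)) [DecidableRel G.Adj]
    (hconn : G.Connected)
    (γ : ℕ → ℝ)
    (hγnonneg : ∀ t, 0 ≤ γ t)
    (hγto0 : Tendsto γ atTop (𝓝 0))
    (hγdiv : Tendsto (fun n => ∑ t ∈ Finset.range n, γ t) atTop atTop)
    (hγsq : Summable (fun t => γ t ^ 2))
    (hmin : ∃ lamstar : Fin N → Fin N → Fin S → ℝ,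
      ∀ lam, etaFn X g G lamstar ≤ etaFn X g G lam)
    (lam : ℕ → Fin N → Fin N → Fin S → ℝ)
    (μ : ℕ → Fin N → Fin S → ℝ)
    (x : ℕ → Fin N → Fin S → ℝ)
    (ρ : ℕ → Fin N → ℝ)
    (hmax : ∀ t i, μ (t + 1) i ∈ unitSimplex S ∧
      ∀ ν ∈ unitSimplex S,
        dualFn X g i ν + ∑ s, ν s * edgeDiff G (lam t) i s ≤
        dualFn X g i (μ (t + 1) i) + ∑ s, μ (t + 1) i s * edgeDiff G (lam t) i s)
    (hxmin : ∀ t i, x (t + 1) i ∈ X i ∧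
      (∀ y ∈ X i,
        (⨆ s : Fin S, (g i s (x (t + 1) i s) + edgeDiff G (lam t) i s)) ≤
        (⨆ s : Fin S, (g i s (y s) + edgeDiff G (lam t) i s))) ∧
      ρ (t + 1) i = ⨆ s : Fin S, (g i s (x (t + 1) i s) + edgeDiff G (lam t) i s))
    (hupd : ∀ t i j, G.Adj i j →
      lam (t + 1) i j = lam t i j - γ t • (μ (t + 1) i - μ (t + 1) j)) :
    ∀ (tn : ℕ → ℕ), StrictMono tn →
      ∀ xbar : Fin N → Fin S → ℝ,
        (∀ i, Tendsto (fun n => x (tn n) i) atTop (𝓝 (xbar i))) →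
        (∀ i, xbar i ∈ X i) ∧
        (⨆ s : Fin S, ∑ i, g i s (xbar i s)) = sInf (primalSet X g) := by
  intro tn htn xbar hx
  obtain ⟨lamstar, hlamstar⟩ := hmin
  have : Nonempty (Fin S) := ⟨⟨0, hS⟩⟩
  have hgc : ∀ i s, Continuous (g i s) := fun i s =>
    continuousOn_univ.1 ((hg i s).continuousOn isOpen_univ)
  have hpos : ∀ᶠ n in atTop, tn n - 1 + 1 = tn n :=
    (htn.tendsto_atTop.eventually_ge_atTop 1).mono fun n hn => Nat.sub_add_cancel hn
  have hmem : ∀ i, xbar i ∈ X i := fun i =>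
    (hXcomp i).isClosed.mem_of_tendsto (hx i) <| hpos.mono fun n hn => by
      rw [← hn]
      exact (hxmin _ i).1
  have heta : Tendsto (fun n => etaFn X g G (lam (tn n - 1))) atTop
      (𝓝 (etaFn X g G lamstar)) :=
    (tendsto_etaFn hXne hXcomp hgc hγnonneg hγdiv hγsq hlamstar hmax hupd).comp
      ((tendsto_sub_atTop_nat 1).comp htn.tendsto_atTop)
  have hprimal : ∀ t s, ∑ i, g i s (x (t + 1) i s) ≤ etaFn X g G (lam t) := by
    intro t s
    have h0 : ∑ i, edgeDiff G (lam t) i s = 0 := by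
      rw [← Finset.sum_apply, sum_edgeDiff, Pi.zero_apply]
    calc ∑ i, g i s (x (t + 1) i s)
        = ∑ i, (g i s (x (t + 1) i s) + edgeDiff G (lam t) i s) := by
          rw [Finset.sum_add_distrib, h0, add_zero]
      _ ≤ ∑ i, localValue X g i (edgeDiff G (lam t) i) := Finset.sum_le_sum fun i _ =>
          (le_ciSup (f := fun s => g i s (x (t + 1) i s) + edgeDiff G (lam t) i s)
            (Set.finite_range _).bddAbove s).trans <|
          le_localValue hS (hXne i) (hXconv i) (hXcomp i) (hg i) (hgc i) (hxmin t i).2.1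
  have hupper : (⨆ s, ∑ i, g i s (xbar i s)) ≤ etaFn X g G lamstar := by
    refine ciSup_le fun s => le_of_tendsto_of_tendsto
      (tendsto_finsetSum _ fun i _ =>
        ((hgc i s).tendsto _).comp ((tendsto_pi_nhds.1 (hx i)) s)) heta ?_
    filter_upwards [hpos] with n hn
    simpa only [hn, Function.comp_apply] using hprimal (tn n - 1) s
  have hlower : ∀ P ∈ primalSet X g, etaFn X g G lamstar ≤ P := by
    rintro _ ⟨y, hy, rfl⟩
    obtain ⟨l, hl⟩ := exists_etaFn_le hN hS hXcomp hgc hconn hy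
    exact (hlamstar l).trans hl
  have hfeas : (⨆ s, ∑ i, g i s (xbar i s)) ∈ primalSet X g := ⟨xbar, hmem, rfl⟩
  exact ⟨hmem, le_antisymm (hupper.trans (le_csInf ⟨_, hfeas⟩ hlower))
    (csInf_le ⟨_, hlower⟩ hfeas)⟩

end
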